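/- Under the joint law of (X, Y₁, …, Y_K) described in the context, the estimation error X − Ŷ is statistically independent of the output vector (Y₁, …, Y_K); in particular X − Ŷ is independent of Ŷ, so the backward channel X = Ŷ + Z̃ is additive (orthogonality principle). -/

import Mathlib

open MeasureTheory

/-- The one-sided exponential distribution `Exp(r)`, with density `r·e^{−r x}` on `x ≥ 0`. -/
noncomputable def expMeasure (r : ℝ) : Measure ℝ :=
  volume.withDensity fun x => if 0 ≤ x then ENNReal.ofReal (r * Real.exp (-r * x)) else 0

/-- The forward test channel `κ(x)` of the one-sided exponential source: an atom of mass
`e^{−δx}` at `0` plus the density `y ↦ δ·e^{−δ(x−y)}` on the interval `(0, x]`. -/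
noncomputable def expChannel (δ : ℝ) (x : ℝ) : Measure ℝ :=
  (ENNReal.ofReal (Real.exp (-δ * x))) • Measure.dirac 0 +
    volume.withDensity
      ((Set.Ioc (0 : ℝ) x).indicator fun y => ENNReal.ofReal (δ * Real.exp (-δ * (x - y))))

/-- The joint law of `(X, Y₁, …, Y_K)`: the composition of `Exp(λ)` (the law of `X`) with the
`K`-fold product kernel `x ↦ κ(x)^{⊗K}`, so that `Y₁, …, Y_K` are conditionally i.i.d. given `X`
with conditional law `κ(X)`. -/
noncomputable def jointLaw (lam δ : ℝ) (K : ℕ) : Measure (ℝ × (Fin K → ℝ)) :=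
  (expMeasure lam).bind fun x =>
    (Measure.pi fun _ : Fin K => expChannel δ x).map fun ys => (x, ys)

open scoped ENNReal

noncomputable def baseNu (δ : ℝ) : Measure ℝ :=
  Measure.dirac 0 +
    (volume.restrict (Set.Ioi (0 : ℝ))).withDensity
      (fun y => ENNReal.ofReal (δ * Real.exp (δ * y)))

instance baseNu_sigmaFinite (δ : ℝ) : SigmaFinite (baseNu δ) := by
  have : SigmaFinite ((volume.restrict (Set.Ioi (0 : ℝ))).withDensity
      (fun y => ENNReal.ofReal (δ * Real.exp (δ * y)))) :=
    SigmaFinite.withDensity_of_ne_top (Filter.Eventually.of_forall fun _ => ENNReal.ofReal_ne_top)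
  unfold baseNu
  infer_instance

lemma expChannel_eq (δ x : ℝ) (hx : 0 ≤ x) :
    expChannel δ x =
      ENNReal.ofReal (Real.exp (-δ * x)) • (baseNu δ).restrict (Set.Icc 0 x) := by
  classical
  have hm : Measurable (fun y : ℝ => ENNReal.ofReal (δ * Real.exp (δ * y))) := by fun_prop
  unfold expChannel baseNu
  rw [Measure.restrict_add, smul_add, restrict_dirac' measurableSet_Icc,
    if_pos (by simp [hx] : (0:ℝ) ∈ Set.Icc 0 x), restrict_withDensity measurableSet_Icc,
    Measure.restrict_restrict measurableSet_Icc, withDensity_indicator measurableSet_Ioc,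
    ← withDensity_smul _ hm]
  have h1 : Set.Icc 0 x ∩ Set.Ioi 0 = Set.Ioc 0 x := by
    ext y; simp only [Set.mem_inter_iff, Set.mem_Icc, Set.mem_Ioi, Set.mem_Ioc]
    constructor
    · rintro ⟨⟨_, h⟩, h'⟩; exact ⟨h', h⟩
    · rintro ⟨h, h'⟩; exact ⟨⟨h.le, h'⟩, h⟩
  rw [h1]
  congr 2
  ext y
  simp only [Pi.smul_apply, smul_eq_mul]
  rw [← ENNReal.ofReal_mul (Real.exp_pos _).le]
  congr 1
  rw [mul_left_comm, ← Real.exp_add]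
  ring_nf

lemma expChannel_prob (δ x : ℝ) (hδ : 0 < δ) (hx : 0 ≤ x) :
    IsProbabilityMeasure (expChannel δ x) := by
  constructor
  unfold expChannel
  rw [Measure.add_apply, Measure.smul_apply, withDensity_indicator measurableSet_Ioc,
    withDensity_apply _ MeasurableSet.univ, Measure.restrict_univ]
  have hcont : Continuous fun y : ℝ => δ * Real.exp (-δ * (x - y)) := by fun_prop
  have hI : ∫ y in (0:ℝ)..x, δ * Real.exp (-δ * (x - y)) = 1 - Real.exp (-δ * x) := by
    rw [intervalIntegral.integral_eq_sub_of_hasDerivAt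
      (f := fun y => Real.exp (-δ * (x - y)))]
    · simp
    · intro y _
      have h1 : HasDerivAt (fun y : ℝ => -δ * (x - y)) (-δ * (0 - 1)) y :=
        ((hasDerivAt_const y x).sub (hasDerivAt_id y)).const_mul (-δ)
      exact h1.exp.congr_deriv (by ring)
    · exact hcont.intervalIntegrable _ _
  rw [← ofReal_integral_eq_lintegral_ofReal, ← intervalIntegral.integral_of_le hx, hI]
  · simp only [measure_univ, smul_eq_mul, mul_one]
    rw [← ENNReal.ofReal_add (Real.exp_pos _).le]
    · simp
    · have : Real.exp (-δ * x) ≤ 1 := Real.exp_le_one_iff.2 (by nlinarith)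
      linarith
  · exact (hcont.integrableOn_Icc (a := 0) (b := x)).mono_set Set.Ioc_subset_Icc_self
  · exact Filter.Eventually.of_forall fun y => by positivity

lemma expMeasure_prob (r : ℝ) (hr : 0 < r) : IsProbabilityMeasure (expMeasure r) := by
  constructor
  unfold expMeasure
  rw [withDensity_apply _ MeasurableSet.univ, Measure.restrict_univ,
    ← ProbabilityTheory.lintegral_exponentialPDF_eq_one hr]
  congr 1
  ext x
  rw [ProbabilityTheory.exponentialPDF_eq]
  split_ifs <;> simp

lemma expMeasure_ae (r : ℝ) : ∀ᵐ x ∂(expMeasure r), 0 ≤ x := by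
  unfold expMeasure
  rw [ae_withDensity_iff (Measurable.ite measurableSet_Ici (by fun_prop) measurable_const)]
  refine Filter.Eventually.of_forall fun x hx => ?_
  by_contra h
  simp [h] at hx

def boxSet (K : ℕ) : Set (ℝ × (Fin K → ℝ)) := {p | ∀ i, 0 ≤ p.2 i ∧ p.2 i ≤ p.1}

lemma measurableSet_boxSet (K : ℕ) : MeasurableSet (boxSet K) := by
  have : boxSet K = ⋂ i, ({p | 0 ≤ p.2 i} ∩ {p | p.2 i ≤ p.1}) := by
    ext p; simp [boxSet]
  rw [this]
  refine MeasurableSet.iInter fun i => ?_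
  exact (measurableSet_le measurable_const (by fun_prop)).inter
    (measurableSet_le (by fun_prop) (by fun_prop))

lemma pi_channel_apply (δ x : ℝ) (hδ : 0 < δ) (hx : 0 ≤ x) (K : ℕ)
    (S : Set (ℝ × (Fin K → ℝ))) (hS : MeasurableSet S) :
    ((Measure.pi fun _ : Fin K => expChannel δ x).map fun ys => (x, ys)) S =
      ENNReal.ofReal (Real.exp (-δ * x)) ^ K *
        (Measure.pi fun _ : Fin K => baseNu δ) (Prod.mk x ⁻¹' (S ∩ boxSet K)) := by
  have := expChannel_prob δ x hδ hx
  have hpi : (Measure.pi fun _ : Fin K => expChannel δ x) =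
      ENNReal.ofReal (Real.exp (-δ * x)) ^ K •
        (Measure.pi fun _ : Fin K => baseNu δ).restrict (Set.univ.pi fun _ => Set.Icc 0 x) := by
    symm
    rw [Measure.restrict_pi_pi]
    refine (Measure.pi_eq fun s hs => ?_).symm
    rw [Measure.smul_apply, Measure.pi_pi, expChannel_eq δ x hx]
    simp [Finset.prod_mul_distrib]
  rw [Measure.map_apply (by fun_prop) hS, hpi, Measure.smul_apply, smul_eq_mul,
    Measure.restrict_apply (measurable_prodMk_left hS)]
  congr 2
  ext y
  simp [boxSet, Pi.le_def, forall_and]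

lemma joint_apply (lam δ : ℝ) (hδ : 0 < δ) (K : ℕ)
    (S : Set (ℝ × (Fin K → ℝ))) (hS : MeasurableSet S) :
    jointLaw lam δ K S = ∫⁻ x, ENNReal.ofReal (Real.exp (-δ * x)) ^ K *
        (Measure.pi fun _ : Fin K => baseNu δ) (Prod.mk x ⁻¹' (S ∩ boxSet K))
        ∂(expMeasure lam) := by
  let g : ℝ → Measure (ℝ × (Fin K → ℝ)) := fun x =>
    ENNReal.ofReal (Real.exp (-δ * x)) ^ K •
      (((Measure.pi fun _ : Fin K => baseNu δ).map (Prod.mk x)).restrict (boxSet K))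
  have hgapp : ∀ x T, MeasurableSet T → g x T = ENNReal.ofReal (Real.exp (-δ * x)) ^ K *
        (Measure.pi fun _ : Fin K => baseNu δ) (Prod.mk x ⁻¹' (T ∩ boxSet K)) := by
    intro x T hT
    simp only [g]
    rw [Measure.smul_apply, smul_eq_mul, Measure.restrict_apply hT,
      Measure.map_apply (by fun_prop) (hT.inter (measurableSet_boxSet K))]
  have hg : Measurable g := by
    refine Measure.measurable_of_measurable_coe _ fun T hT => ?_
    simp only [hgapp _ T hT]
    refine Measurable.mul (by fun_prop) ?_
    exact measurable_measure_prodMk_left (hT.inter (measurableSet_boxSet K))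
  have hae : (fun x => (Measure.pi fun _ : Fin K => expChannel δ x).map fun ys => (x, ys))
      =ᵐ[expMeasure lam] g := by
    filter_upwards [expMeasure_ae lam] with x hx
    ext T hT
    rw [pi_channel_apply δ x hδ hx K T hT, hgapp x T hT]
  unfold jointLaw
  rw [Measure.bind_apply hS (hg.aemeasurable.congr hae.symm)]
  refine lintegral_congr_ae ?_
  filter_upwards [expMeasure_ae lam] with x hx
  exact pi_channel_apply δ x hδ hx K S hS

lemma joint_univ (lam δ : ℝ) (hlam : 0 < lam) (hδ : 0 < δ) (K : ℕ) :
    jointLaw lam δ K Set.univ = 1 := by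
  have := expMeasure_prob lam hlam
  rw [joint_apply lam δ hδ K _ MeasurableSet.univ]
  have : ∫⁻ x, (1:ℝ≥0∞) ∂(expMeasure lam) = 1 := by simp
  rw [← this]
  refine lintegral_congr_ae ?_
  filter_upwards [expMeasure_ae lam] with x hx
  have := expChannel_prob δ x hδ hx
  rw [← pi_channel_apply δ x hδ hx K _ MeasurableSet.univ,
    Measure.map_apply (by fun_prop) MeasurableSet.univ]
  simp

lemma measurable_max (K : ℕ) : Measurable (fun y : Fin K → ℝ => ⨆ i, y i) :=
  Measurable.iSup fun i => measurable_pi_apply i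

lemma joint_factor (lam δ : ℝ) (hlam : 0 < lam) (hδ : 0 < δ) (K : ℕ) (hK : 1 ≤ K) :
    ∃ (a : Set ℝ → ℝ≥0∞) (b : Set (Fin K → ℝ) → ℝ≥0∞), ∀ A B, MeasurableSet A →
      MeasurableSet B → jointLaw lam δ K
        ((fun p : ℝ × (Fin K → ℝ) => p.1 - ⨆ i, p.2 i) ⁻¹' A ∩ (fun p => p.2) ⁻¹' B)
          = a A * b B := by
  classical
  have : Nonempty (Fin K) := ⟨⟨0, hK⟩⟩
  let m : (Fin K → ℝ) → ℝ := fun y => ⨆ i, y i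
  have hm : Measurable m := measurable_max K
  let f : ℝ → ℝ≥0∞ := fun x => ENNReal.ofReal (lam * Real.exp (-(lam + K * δ) * x))
  have hf : Measurable f := by fun_prop
  let e : ℝ → ℝ≥0∞ := fun x => ENNReal.ofReal (Real.exp (-(lam + K * δ) * x))
  refine ⟨fun A => ∫⁻ z, (A ∩ Set.Ici 0).indicator f z,
    fun B => ∫⁻ y, (B ∩ {y | ∀ i, 0 ≤ y i}).indicator (fun y => e (m y)) y
      ∂(Measure.pi fun _ : Fin K => baseNu δ), fun A B hA hB => ?_⟩
  have hS : MeasurableSet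
      ((fun p : ℝ × (Fin K → ℝ) => p.1 - ⨆ i, p.2 i) ⁻¹' A ∩ (fun p => p.2) ⁻¹' B) :=
    ((measurable_fst.sub (hm.comp measurable_snd)) hA).inter (measurable_snd hB)
  rw [joint_apply lam δ hδ K _ hS]
  set S := ((fun p : ℝ × (Fin K → ℝ) => p.1 - ⨆ i, p.2 i) ⁻¹' A ∩ (fun p => p.2) ⁻¹' B)
    ∩ boxSet K with hSdef
  have hSm : MeasurableSet S := hS.inter (measurableSet_boxSet K)
  have hpm : Measurable fun x => (Measure.pi fun _ : Fin K => baseNu δ) (Prod.mk x ⁻¹' S) :=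
    measurable_measure_prodMk_left hSm
  unfold expMeasure
  have hd : Measurable (fun x : ℝ => if 0 ≤ x then
        ENNReal.ofReal (lam * Real.exp (-lam * x)) else 0) :=
    Measurable.ite measurableSet_Ici (by fun_prop) measurable_const
  have hk : Measurable (fun x : ℝ => ENNReal.ofReal (Real.exp (-δ * x)) ^ K *
        (Measure.pi fun _ : Fin K => baseNu δ) (Prod.mk x ⁻¹' S)) :=
    Measurable.mul (by fun_prop) hpm
  rw [lintegral_withDensity_eq_lintegral_mul _ hd hk]
  have h1 : ∀ x : ℝ, ((fun x : ℝ => if 0 ≤ x then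
        ENNReal.ofReal (lam * Real.exp (-lam * x)) else 0) * fun x =>
        ENNReal.ofReal (Real.exp (-δ * x)) ^ K *
        (Measure.pi fun _ : Fin K => baseNu δ) (Prod.mk x ⁻¹' S)) x =
      ∫⁻ y, S.indicator (fun p => f p.1) (x, y) ∂(Measure.pi fun _ : Fin K => baseNu δ) := by
    intro x
    have h2 : ∀ y, S.indicator (fun p => f p.1) (x, y) =
        (Prod.mk x ⁻¹' S).indicator (fun _ => f x) y := fun y => by
      simp [Set.indicator_apply]
    simp_rw [h2]
    rw [lintegral_indicator_const (measurable_prodMk_left hSm)]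
    simp only [Pi.mul_apply]
    split_ifs with hx
    · rw [← mul_assoc, ← ENNReal.ofReal_pow (Real.exp_pos _).le,
        ← ENNReal.ofReal_mul (by positivity), ← Real.exp_nat_mul, mul_assoc lam, ← Real.exp_add]
      simp only [f]
      ring_nf
    · have : Prod.mk x ⁻¹' S = ∅ := by
        ext y
        simp only [hSdef, boxSet, Set.mem_preimage, Set.mem_inter_iff, Set.mem_setOf_eq,
          Set.mem_empty_iff_false, iff_false]
        rintro ⟨_, h⟩
        have := h ⟨0, hK⟩
        exact hx (this.1.trans this.2)
      simp [this]
  simp_rw [h1]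
  rw [lintegral_lintegral_swap]
  · have hA' : Measurable ((A ∩ Set.Ici 0).indicator f) :=
      hf.indicator (hA.inter measurableSet_Ici)
    have hB0 : MeasurableSet {y : Fin K → ℝ | ∀ i, 0 ≤ y i} := by
      rw [Set.setOf_forall]
      exact MeasurableSet.iInter fun i => measurableSet_le measurable_const (by fun_prop)
    have hB' : Measurable ((B ∩ {y : Fin K → ℝ | ∀ i, 0 ≤ y i}).indicator
        (fun y => e (m y))) :=
      Measurable.indicator (by fun_prop) (hB.inter hB0)
    rw [← lintegral_const_mul _ hB']
    refine lintegral_congr fun y => ?_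
    rw [← lintegral_add_right_eq_self _ (m y), ← lintegral_mul_const _ hA']
    refine lintegral_congr fun z => ?_
    have hmem : (z + m y, y) ∈ S ↔ z ∈ A ∩ Set.Ici 0 ∧ y ∈ B ∩ {y | ∀ i, 0 ≤ y i} := by
      have hle : (∀ i, y i ≤ z + m y) ↔ 0 ≤ z := by
        rw [← ciSup_le_iff (Set.finite_range y).bddAbove]
        change m y ≤ z + m y ↔ _
        constructor <;> intro h <;> linarith
      have hz : z + m y - (⨆ i, y i) = z := by simp [m]
      simp only [hSdef, boxSet, Set.mem_preimage, Set.mem_inter_iff, Set.mem_setOf_eq,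
        forall_and, hle, hz, Set.mem_Ici]
      tauto
    by_cases hz : z ∈ A ∩ Set.Ici 0 <;> by_cases hy : y ∈ B ∩ {y | ∀ i, 0 ≤ y i}
    · rw [Set.indicator_of_mem (hmem.2 ⟨hz, hy⟩), Set.indicator_of_mem hz,
        Set.indicator_of_mem hy]
      simp only [f, e]
      rw [← ENNReal.ofReal_mul (by positivity), mul_assoc, ← Real.exp_add]
      ring_nf
    · rw [Set.indicator_of_notMem (fun h => hy (hmem.1 h).2), Set.indicator_of_notMem hy, mul_zero]
    · rw [Set.indicator_of_notMem (fun h => hz (hmem.1 h).1), Set.indicator_of_notMem hz, zero_mul]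
    · rw [Set.indicator_of_notMem (fun h => hz (hmem.1 h).1), Set.indicator_of_notMem hz, zero_mul]
  · exact (Measurable.indicator (hf.comp measurable_fst) hSm).aemeasurable

/-- orthogonality principle: under the joint law of `(X, Y₁, …, Y_K)`, the
estimation error `Z̃ = X − Ŷ` of the select-max estimator `Ŷ = max{Y₁,…,Y_K}` is statistically
independent of the output vector `(Y₁, …, Y_K)`; in particular `X − Ŷ` is independent of `Ŷ`,
so the backward channel `X = Ŷ + Z̃` is additive. -/
theorem selectMax_error_indep (lam D : ℝ) (hlam : 0 < lam) (hD : 0 < D)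
    (hD' : D < 1 / lam) (K : ℕ) (hK : 1 ≤ K) :
    ProbabilityTheory.IndepFun (fun p : ℝ × (Fin K → ℝ) => p.1 - ⨆ i, p.2 i)
        (fun p : ℝ × (Fin K → ℝ) => p.2) (jointLaw lam (1 / D - lam) K) ∧
      ProbabilityTheory.IndepFun (fun p : ℝ × (Fin K → ℝ) => p.1 - ⨆ i, p.2 i)
        (fun p : ℝ × (Fin K → ℝ) => ⨆ i, p.2 i) (jointLaw lam (1 / D - lam) K) := by
  have hδ : 0 < 1 / D - lam := by
    have : lam < 1 / D := by
      rw [lt_div_iff₀ hlam] at hD'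
      rw [lt_div_iff₀ hD]
      linarith
    linarith
  have key : ProbabilityTheory.IndepFun (fun p : ℝ × (Fin K → ℝ) => p.1 - ⨆ i, p.2 i)
        (fun p : ℝ × (Fin K → ℝ) => p.2) (jointLaw lam (1 / D - lam) K) := by
    rw [ProbabilityTheory.indepFun_iff_measure_inter_preimage_eq_mul]
    intro A B hA hB
    obtain ⟨a, b, h⟩ := joint_factor lam _ hlam hδ K hK
    have hu := h _ _ MeasurableSet.univ MeasurableSet.univ
    have h1 := h _ _ hA MeasurableSet.univ
    have h2 := h _ _ MeasurableSet.univ hB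
    simp only [Set.preimage_univ, Set.univ_inter, Set.inter_univ] at hu h1 h2
    rw [joint_univ lam _ hlam hδ] at hu
    rw [h A B hA hB, h1, h2]
    calc a A * b B = a A * b B * (a Set.univ * b Set.univ) := by rw [← hu, mul_one]
      _ = _ := by ring
  exact ⟨key, key.comp measurable_id (measurable_max K)⟩
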